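/- arXiv:2501.06674 — 12 statements merged into one kernel-verified Lean document; each statement's English description precedes it below -/
import Mathlib

section
/- For every r ∈ (0,1) and every a ∈ ℂ, −(1/2)·Im( a · ∫_0^π (r·e^{−iθ} + 1)² · i·e^{iθ} dθ ) = −Im(a)·(r² − 1) − π·Re(a)·r. -/
open Complex

/-- The integral over the upper half circle, valid for every complex `r`. -/
theorem integral_mul_exp_neg_add_one_sq_mul (r : ℂ) :
    ∫ θ in (0:ℝ)..Real.pi, (r * exp (-(I * (θ : ℂ))) + 1) ^ 2 * (I * exp (I * (θ : ℂ))) =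
      2 * (r ^ 2 - 1) + 2 * Real.pi * r * I := by
  have hderiv (θ : ℝ) : HasDerivAt
      (fun t : ℝ => -r ^ 2 * exp (-(I * (t : ℂ))) + 2 * r * (I * (t : ℂ)) + exp (I * (t : ℂ)))
      ((r * exp (-(I * (θ : ℂ))) + 1) ^ 2 * (I * exp (I * (θ : ℂ)))) θ := by
    have hI : HasDerivAt (fun t : ℝ => I * (t : ℂ)) I θ := by
      simpa using (ofRealCLM.hasDerivAt (x := θ)).const_mul I
    have hexp : exp (-(I * (θ : ℂ))) * exp (I * (θ : ℂ)) = 1 := by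
      rw [← exp_add, neg_add_cancel, exp_zero]
    refine (((hI.neg.cexp.const_mul (-r ^ 2)).add (hI.const_mul (2 * r))).add hI.cexp).congr_deriv ?_
    simp only [Pi.neg_apply]
    linear_combination -(r ^ 2 * I * exp (-(I * (θ : ℂ))) + 2 * r * I) * hexp
  have hpi : exp (I * (Real.pi : ℂ)) = -1 := by rw [mul_comm, exp_pi_mul_I]
  rw [intervalIntegral.integral_eq_sub_of_hasDerivAt (fun θ _ => hderiv θ)
    (Continuous.intervalIntegrable (by fun_prop) _ _)]
  simp only [exp_neg, hpi, ofReal_zero, mul_zero, exp_zero]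
  norm_num
  ring

/-- Evaluation of the integral `I⁺₀,₀(r)`: for `r ∈ (0,1)` and `a ∈ ℂ`,
`−(1/2)·Im( a · ∫_0^π (r·e^{−iθ} + 1)² · i·e^{iθ} dθ ) = −Im(a)·(r² − 1) − π·Re(a)·r`. -/
theorem I00_eval (r : ℝ) (hr : r ∈ Set.Ioo (0:ℝ) 1) (a : ℂ) :
    -(1/2 : ℝ) * (a * ∫ θ in (0:ℝ)..Real.pi,
        ((r : ℂ) * Complex.exp (-(Complex.I * (θ : ℂ))) + 1) ^ 2 *
          (Complex.I * Complex.exp (Complex.I * (θ : ℂ)))).im =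
      -a.im * (r ^ 2 - 1) - Real.pi * a.re * r := by
  have h : (2 * ((r : ℂ) ^ 2 - 1) + 2 * Real.pi * r * I) =
      ((2 * (r ^ 2 - 1) : ℝ) : ℂ) + ((2 * Real.pi * r : ℝ) : ℂ) * I := by
    push_cast
    ring
  rw [integral_mul_exp_neg_add_one_sq_mul, h, mul_im]
  simp only [add_re, add_im, ofReal_re, ofReal_im, re_ofReal_mul, im_ofReal_mul, I_re, I_im]
  ring
end

section
/- For every r ∈ (0,1) and every a ∈ ℂ, −(1/2)·Im( a · ∫_0^π ((r·e^{−iθ} + 1)²·(r·e^{iθ} − 1)/(r·e^{iθ} + 1)) · i·e^{iθ} dθ ) = −(Im(a)/r)·( −r(1+r²) + 2(r²−1)²·arctanh r ) − π·Re(a)·r·(r²−1). (Note that r·e^{iθ} + 1 ≠ 0 since 0 < r < 1.) -/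
open Complex

/-- The real inverse hyperbolic tangent, `arctanh r = (1/2)·ln((1+r)/(1−r))`. -/
noncomputable def arctanh (r : ℝ) : ℝ := (1/2) * Real.log ((1 + r) / (1 - r))

lemma one_add_mul_exp_mem_slitPlane {r : ℝ} (hr : r ∈ Set.Ioo (0 : ℝ) 1) (θ : ℝ) :
    1 + (r : ℂ) * exp (I * θ) ∈ slitPlane := by
  refine mem_slitPlane_of_norm_lt_one ?_
  rw [norm_mul, mul_comm I, norm_exp_ofReal_mul_I, mul_one, norm_real, Real.norm_of_nonneg hr.1.le]
  exact hr.2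

/-- With `w = exp (iθ)`, the integrand `((r / w + 1)² (r w - 1) / (r w + 1)) i w` has an explicit
primitive, found by partial fractions in `w`. -/
lemma hasDerivAt_primitive {r : ℝ} (hr : r ∈ Set.Ioo (0 : ℝ) 1) (θ : ℝ) :
    HasDerivAt (fun θ : ℝ => exp (I * θ) + 2 * r * ((r : ℂ) ^ 2 - 1) * (I * θ)
        + (r : ℂ) ^ 2 * exp (-(I * θ))
        - 2 * (1 - (r : ℂ) ^ 2) ^ 2 / r * log (1 + r * exp (I * θ)))
      ((((r : ℂ) * exp (-(I * θ)) + 1) ^ 2 * ((r : ℂ) * exp (I * θ) - 1) /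
        ((r : ℂ) * exp (I * θ) + 1)) * (I * exp (I * θ))) θ := by
  have hs := one_add_mul_exp_mem_slitPlane hr θ
  have hlin : HasDerivAt (fun θ : ℝ => I * (θ : ℂ)) I θ := by
    simpa using (ofRealCLM.hasDerivAt (x := θ)).const_mul I
  have hexp := hlin.cexp
  have hlog := ((hexp.const_mul (r : ℂ)).const_add 1).clog_real hs
  refine (((hexp.add (hlin.const_mul (2 * r * ((r : ℂ) ^ 2 - 1)))).add
    (hlin.neg.cexp.const_mul ((r : ℂ) ^ 2))).sub
    (hlog.const_mul (2 * (1 - (r : ℂ) ^ 2) ^ 2 / r))).congr_deriv ?_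
  have h1 : exp (I * θ) * r + 1 ≠ 0 := by
    rw [mul_comm, add_comm]
    exact slitPlane_ne_zero hs
  have hr0 : (r : ℂ) ≠ 0 := ofReal_ne_zero.2 hr.1.ne'
  rw [Pi.neg_apply, exp_neg]
  have hw := exp_ne_zero (I * θ)
  generalize exp (I * θ) = w at *
  rw [add_comm 1 ((r : ℂ) * w), mul_comm (r : ℂ) w]
  field_simp
  ring

lemma integral_eq {r : ℝ} (hr : r ∈ Set.Ioo (0 : ℝ) 1) :
    ∫ θ in (0 : ℝ)..Real.pi,
        (((r : ℂ) * exp (-(I * θ)) + 1) ^ 2 * ((r : ℂ) * exp (I * θ) - 1) /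
          ((r : ℂ) * exp (I * θ) + 1)) * (I * exp (I * θ)) =
      ((-2 * (1 + r ^ 2) + 4 * (r ^ 2 - 1) ^ 2 / r * arctanh r : ℝ) : ℂ)
        + ((2 * Real.pi * r * (r ^ 2 - 1) : ℝ) : ℂ) * I := by
  have hne (θ : ℝ) : (r : ℂ) * exp (I * θ) + 1 ≠ 0 := by
    rw [add_comm]
    exact slitPlane_ne_zero (one_add_mul_exp_mem_slitPlane hr θ)
  rw [intervalIntegral.integral_eq_sub_of_hasDerivAt (fun θ _ => hasDerivAt_primitive hr θ)
    (Continuous.intervalIntegrable (by fun_prop (disch := exact hne _)) _ _)]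
  have hpos : 0 < 1 + r := by linarith [hr.1]
  have hneg : 0 < 1 - r := by linarith [hr.2]
  have hpi : exp (I * Real.pi) = -1 := by rw [mul_comm, exp_pi_mul_I]
  have hl1 : log (1 + (r : ℂ)) = (Real.log (1 + r) : ℂ) := by
    rw [ofReal_log hpos.le]; push_cast; rfl
  have hl2 : log (1 + (r : ℂ) * -1) = (Real.log (1 - r) : ℂ) := by
    rw [ofReal_log hneg.le]; push_cast; ring_nf
  have hr0 : (r : ℂ) ≠ 0 := ofReal_ne_zero.2 hr.1.ne'
  rw [exp_neg, hpi, hl2, arctanh, Real.log_div hpos.ne' hneg.ne']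
  simp only [ofReal_zero, mul_zero, neg_zero, exp_zero, mul_one, hl1]
  push_cast
  field_simp
  ring

/-- Evaluation of the integral `I⁺₁,₁(r)`: for `r ∈ (0,1)` and `a ∈ ℂ`,
`−(1/2)·Im( a · ∫_0^π ((r·e^{−iθ}+1)²·(r·e^{iθ}−1)/(r·e^{iθ}+1)) · i·e^{iθ} dθ )
  = −(Im(a)/r)·(−r(1+r²) + 2(r²−1)²·arctanh r) − π·Re(a)·r·(r²−1)`. -/
theorem I11_eval (r : ℝ) (hr : r ∈ Set.Ioo (0:ℝ) 1) (a : ℂ) :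
    -(1/2 : ℝ) * (a * ∫ θ in (0:ℝ)..Real.pi,
        (((r : ℂ) * Complex.exp (-(Complex.I * (θ : ℂ))) + 1) ^ 2 *
            ((r : ℂ) * Complex.exp (Complex.I * (θ : ℂ)) - 1) /
          ((r : ℂ) * Complex.exp (Complex.I * (θ : ℂ)) + 1)) *
          (Complex.I * Complex.exp (Complex.I * (θ : ℂ)))).im =
      -(a.im / r) * (-r * (1 + r ^ 2) + 2 * (r ^ 2 - 1) ^ 2 * arctanh r) -
        Real.pi * a.re * r * (r ^ 2 - 1) := by
  have hr0 : r ≠ 0 := hr.1.ne'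
  rw [integral_eq hr, mul_im]
  simp only [add_re, add_im, re_ofReal_mul, im_ofReal_mul, ofReal_re, ofReal_im, I_re, I_im]
  field_simp
  ring
end

section
/- Let a, b, c, d, α, β, γ be real numbers, not all zero, and define h : (0,1) → ℝ by h(r) = a·r + b·r² + c·r³ + d·r⁴ + α·(r²−1)²·arctanh r + β·(r⁴−1)·arctanh r + γ·r²·arctanh r. Then h has at most 6 zeros in (0,1); that is, the set {r ∈ (0,1) : h(r) = 0} has at most 6 elements. -/
open Polynomial

theorem hasDerivAt_arctanh {r : ℝ} (h₁ : -1 < r) (h₂ : r < 1) :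
    HasDerivAt arctanh (1 / (1 - r ^ 2)) r := by
  have hp : 1 + r ≠ 0 := by linarith
  have hm : 1 - r ≠ 0 := by linarith
  have hs : 1 - r ^ 2 ≠ 0 := by
    rw [show 1 - r ^ 2 = (1 + r) * (1 - r) by ring]
    exact mul_ne_zero hp hm
  have h : HasDerivAt arctanh _ r := (((((hasDerivAt_id r).const_add 1).div ((hasDerivAt_id r).const_sub 1) hm).log
    (div_ne_zero hp hm)).const_mul (1 / 2 : ℝ))
  refine h.congr_deriv ?_
  simp only [id, Pi.div_apply]
  field_simp
  ring

/-- Rolle's theorem, as a bound on the number of zeros: passing from `f'` to `f` gains at most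
one zero. -/
theorem encard_zeros_le_succ {f f' : ℝ → ℝ} {u v : ℝ} {n : ℕ}
    (hf : ∀ x ∈ Set.Ico u v, HasDerivAt f (f' x) x)
    (hn : {x ∈ Set.Ioo u v | f' x = 0}.encard ≤ n) :
    {x ∈ Set.Ico u v | f x = 0}.encard ≤ (n + 1 : ℕ) := by
  have hfin : {x ∈ Set.Ioo u v | f' x = 0}.Finite := Set.finite_of_encard_le_coe hn
  have key (s : Finset ℝ) (hs : (s : Set ℝ) ⊆ {x ∈ Set.Ico u v | f x = 0}) :
      s.card ≤ n + 1 := by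
    have hle : s.card ≤ hfin.toFinset.card + 1 := by
      refine Finset.card_le_of_interleaved fun x hx y hy hxy _ => ?_
      obtain ⟨hxI, hx0⟩ := hs hx
      obtain ⟨hyI, hy0⟩ := hs hy
      have hsub (z : ℝ) (hz : z ∈ Set.Icc x y) : z ∈ Set.Ico u v :=
        ⟨hxI.1.trans hz.1, hz.2.trans_lt hyI.2⟩
      obtain ⟨z, hz, hz0⟩ := exists_hasDerivAt_eq_zero hxy
        (fun w hw => (hf w (hsub w hw)).continuousAt.continuousWithinAt)
        (hx0.trans hy0.symm) fun w hw => hf w (hsub w (Set.Ioo_subset_Icc_self hw))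
      refine ⟨z, ?_, hz.1, hz.2⟩
      simp only [Set.Finite.mem_toFinset, Set.mem_ofPred_eq]
      exact ⟨⟨hxI.1.trans_lt hz.1, hz.2.trans hyI.2⟩, hz0⟩
    rw [hfin.encard_eq_coe_toFinset_card] at hn
    have : hfin.toFinset.card ≤ n := by exact_mod_cast hn
    omega
  by_contra! hlt
  obtain ⟨t, ht, htc⟩ := Set.exists_subset_encard_eq
    (show ((n + 2 : ℕ) : ℕ∞) ≤ {x ∈ Set.Ico u v | f x = 0}.encard by
      simpa [add_assoc, one_add_one_eq_two] using Order.add_one_le_of_lt hlt)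
  have htf : t.Finite := Set.finite_of_encard_eq_coe htc
  have := key htf.toFinset (by simpa using ht)
  rw [htf.encard_eq_coe_toFinset_card] at htc
  have : htf.toFinset.card = n + 2 := by exact_mod_cast htc
  omega

theorem Polynomial.encard_zeros_le {p : ℝ[X]} (hp : p ≠ 0) {n : ℕ} (hn : p.natDegree ≤ n) :
    {x | p.eval x = 0}.encard ≤ n := by
  classical
  have h : {x | p.eval x = 0} = (p.roots.toFinset : Set ℝ) := by
    ext x
    simp [hp]
  rw [h, Set.encard_coe_eq_coe_finsetCard]
  exact_mod_cast (Multiset.toFinset_card_le _).trans ((card_roots' p).trans hn)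

/-- The functions `p + q · arctanh + n / (1 - r²)ᵏ`, a class closed under differentiation. -/
noncomputable def arctanhForm (p q n : ℝ[X]) (k : ℕ) (r : ℝ) : ℝ :=
  p.eval r + q.eval r * arctanh r + n.eval r / (1 - r ^ 2) ^ k

/-- The numerator of the rational part of the derivative of `arctanhForm p q n k`. -/
noncomputable def arctanhNumerator (q n : ℝ[X]) (k : ℕ) : ℝ[X] :=
  derivative n * (1 - X ^ 2) + 2 * (k : ℝ[X]) * X * n + q * (1 - X ^ 2) ^ k

theorem hasDerivAt_arctanhForm (p q n : ℝ[X]) (k : ℕ) {r : ℝ} (h₁ : -1 < r) (h₂ : r < 1) :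
    HasDerivAt (arctanhForm p q n k)
      (arctanhForm (derivative p) (derivative q) (arctanhNumerator q n k) (k + 1) r) r := by
  have hs : 1 - r ^ 2 ≠ 0 := by nlinarith
  have hd := (((hasDerivAt_id r).pow 2).const_sub 1).pow k
  have h : HasDerivAt (arctanhForm p q n k) _ r := ((p.hasDerivAt r).add ((q.hasDerivAt r).mul (hasDerivAt_arctanh h₁ h₂))).add
    ((n.hasDerivAt r).div hd (pow_ne_zero k hs))
  refine h.congr_deriv ?_
  rcases k with _ | k
  · simp [arctanhForm, arctanhNumerator]
    field_simp
    ring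
  · simp [arctanhForm, arctanhNumerator]
    field_simp
    ring

theorem encard_zeros_arctanhForm_le_succ {p q n : ℝ[X]} {k m : ℕ}
    (h : {r ∈ Set.Ioo (0 : ℝ) 1 | arctanhForm (derivative p) (derivative q)
      (arctanhNumerator q n k) (k + 1) r = 0}.encard ≤ m) :
    {r ∈ Set.Ico (0 : ℝ) 1 | arctanhForm p q n k r = 0}.encard ≤ (m + 1 : ℕ) :=
  encard_zeros_le_succ
    (fun _ hx => hasDerivAt_arctanhForm p q n k (by linarith [hx.1]) hx.2) h

theorem encard_zeros_Ioo_le {f : ℝ → ℝ} {m : ℕ}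
    (h : {r ∈ Set.Ico (0 : ℝ) 1 | f r = 0}.encard ≤ m) :
    {r ∈ Set.Ioo (0 : ℝ) 1 | f r = 0}.encard ≤ m := by
  refine le_trans (Set.encard_le_encard fun r hr => ?_) h
  exact ⟨Set.Ioo_subset_Ico_self hr.1, hr.2⟩

theorem arctanhForm_fifth_derivative (a b c d q₀ q₁ q₂ r : ℝ) :
    let p : ℝ[X] := C a * X + C b * X ^ 2 + C c * X ^ 3 + C d * X ^ 4
    let q : ℝ[X] := C q₀ + C q₁ * X ^ 2 + C q₂ * X ^ 4
    let n₁ := arctanhNumerator q 0 0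
    let n₂ := arctanhNumerator (derivative q) n₁ 1
    let n₃ := arctanhNumerator (derivative (derivative q)) n₂ 2
    let n₄ := arctanhNumerator (derivative (derivative (derivative q))) n₃ 3
    let n₅ := arctanhNumerator (derivative (derivative (derivative (derivative q)))) n₄ 4
    arctanhForm (derivative (derivative (derivative (derivative (derivative p)))))
      (derivative (derivative (derivative (derivative (derivative q))))) n₅ 5 r =
      (C (24 * q₀ + 40 * q₁ + 120 * q₂) + C (240 * q₀ + 304 * q₁ + 240 * q₂) * X +
        C (120 * q₀ + 40 * q₁ + 24 * q₂) * X ^ 2 : ℝ[X]).eval (r ^ 2) / (1 - r ^ 2) ^ 5 := by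
  intro p q n₁ n₂ n₃ n₄ n₅
  simp [p, q, n₁, n₂, n₃, n₄, n₅, arctanhForm, arctanhNumerator, derivative_pow]
  ring

theorem encard_zeros_quadratic_sq_le {e₀ e₁ e₂ : ℝ} (he : ¬(e₀ = 0 ∧ e₁ = 0 ∧ e₂ = 0)) :
    {r ∈ Set.Ioo (0 : ℝ) 1 |
      (C e₀ + C e₁ * X + C e₂ * X ^ 2 : ℝ[X]).eval (r ^ 2) = 0}.encard ≤ (2 : ℕ) := by
  have hp : (C e₀ + C e₁ * X + C e₂ * X ^ 2 : ℝ[X]) ≠ 0 := by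
    intro h
    have h0 := congrArg (coeff · 0) h
    have h1 := congrArg (coeff · 1) h
    have h2 := congrArg (coeff · 2) h
    simp [coeff_X, coeff_C] at h0 h1 h2
    exact he ⟨h0, h1, h2⟩
  have hinj : Set.InjOn (fun r : ℝ => r ^ 2) {r ∈ Set.Ioo (0 : ℝ) 1 |
      (C e₀ + C e₁ * X + C e₂ * X ^ 2 : ℝ[X]).eval (r ^ 2) = 0} := fun x hx y hy hxy =>
    (pow_left_inj₀ hx.1.1.le hy.1.1.le two_ne_zero).1 hxy
  rw [← hinj.encard_image]
  refine (Set.encard_le_encard ?_).trans (Polynomial.encard_zeros_le hp (by compute_degree))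
  rintro _ ⟨r, hr, rfl⟩
  exact hr.2

/-- Any nonzero element of the span of
`[r, r², r³, r⁴, (r²−1)²·arctanh r, (r⁴−1)·arctanh r, r²·arctanh r]`
has at most 6 zeros in `(0,1)`. -/
theorem span_F_at_most_six_zeros (a b c d α β γ : ℝ)
    (hne : ¬ (a = 0 ∧ b = 0 ∧ c = 0 ∧ d = 0 ∧ α = 0 ∧ β = 0 ∧ γ = 0)) :
    {r ∈ Set.Ioo (0:ℝ) 1 |
        a * r + b * r ^ 2 + c * r ^ 3 + d * r ^ 4 + α * (r ^ 2 - 1) ^ 2 * arctanh r +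
          β * (r ^ 4 - 1) * arctanh r + γ * r ^ 2 * arctanh r = 0}.encard ≤ 6 := by
  by_cases hq : α = 0 ∧ β = 0 ∧ γ = 0
  · obtain ⟨rfl, rfl, rfl⟩ := hq
    have hp : (C a * X + C b * X ^ 2 + C c * X ^ 3 + C d * X ^ 4 : ℝ[X]) ≠ 0 := by
      intro h
      have h1 := congrArg (coeff · 1) h
      have h2 := congrArg (coeff · 2) h
      have h3 := congrArg (coeff · 3) h
      have h4 := congrArg (coeff · 4) h
      simp at h1 h2 h3 h4
      exact hne ⟨h1, h2, h3, h4, rfl, rfl, rfl⟩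
    refine (Set.encard_le_encard fun r hr => ?_).trans
      (Polynomial.encard_zeros_le hp (n := 6) (le_trans (b := 4) (by compute_degree) (by norm_num)))
    simpa using hr.2
  · set p : ℝ[X] := C a * X + C b * X ^ 2 + C c * X ^ 3 + C d * X ^ 4
    set q : ℝ[X] := C (α - β) + C (γ - 2 * α) * X ^ 2 + C (α + β) * X ^ 4
    have hIco : {r ∈ Set.Ico (0 : ℝ) 1 | arctanhForm p q 0 0 r = 0}.encard ≤ (7 : ℕ) := by
      refine encard_zeros_arctanhForm_le_succ <| encard_zeros_Ioo_le <|
        encard_zeros_arctanhForm_le_succ <| encard_zeros_Ioo_le <|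
        encard_zeros_arctanhForm_le_succ <| encard_zeros_Ioo_le <|
        encard_zeros_arctanhForm_le_succ <| encard_zeros_Ioo_le <|
        encard_zeros_arctanhForm_le_succ ?_
      refine (Set.encard_le_encard fun r hr => ?_).trans
        (encard_zeros_quadratic_sq_le (e₀ := 24 * (α - β) + 40 * (γ - 2 * α) + 120 * (α + β))
          (e₁ := 240 * (α - β) + 304 * (γ - 2 * α) + 240 * (α + β))
          (e₂ := 120 * (α - β) + 40 * (γ - 2 * α) + 24 * (α + β)) ?_)
      · have hs : (1 - r ^ 2) ^ 5 ≠ 0 := pow_ne_zero 5 (by nlinarith [hr.1.1, hr.1.2])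
        have h5 := (arctanhForm_fifth_derivative a b c d (α - β) (γ - 2 * α) (α + β)
          r).symm.trans hr.2
        exact ⟨hr.1, (div_eq_zero_iff.1 h5).resolve_right hs⟩
      · rintro ⟨h0, h1, h2⟩
        exact hq ⟨by linarith, by linarith, by linarith⟩
    have hsub : insert 0 {r ∈ Set.Ioo (0:ℝ) 1 |
        a * r + b * r ^ 2 + c * r ^ 3 + d * r ^ 4 + α * (r ^ 2 - 1) ^ 2 * arctanh r +
          β * (r ^ 4 - 1) * arctanh r + γ * r ^ 2 * arctanh r = 0} ⊆
        {r ∈ Set.Ico (0 : ℝ) 1 | arctanhForm p q 0 0 r = 0} := by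
      rintro r (rfl | ⟨hr, hr0⟩)
      · simp [arctanhForm, arctanh, p]
      · refine ⟨Set.Ioo_subset_Ico_self hr, ?_⟩
        rw [← hr0]
        simp [arctanhForm, p, q]
        ring
    have h := (Set.encard_le_encard hsub).trans hIco
    rw [Set.encard_insert_of_notMem (by simp)] at h
    exact (ENat.add_le_add_iff_right ENat.one_ne_top).1 (h.trans_eq (by norm_num))
end

section
/- Let a, b, c, d, α be real numbers, not all zero, and define h : (0,1) → ℝ by h(r) = a·r + b·r² + c·r³ + d·r⁴ + α·(r²−1)²·arctanh r. Then h has at most 4 zeros in (0,1); that is, the set {r ∈ (0,1) : h(r) = 0} has at most 4 elements. -/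
/-- Rolle's theorem for several zeros: between `n + 1` zeros of a function lie `n` zeros of its
derivative. -/
theorem exists_strictMono_hasDerivAt_eq_zero {n : ℕ} {s : Set ℝ} [s.OrdConnected] {f f' : ℝ → ℝ}
    (hf : ∀ x ∈ s, HasDerivAt f (f' x) x) {z : Fin (n + 1) → ℝ} (hz : StrictMono z)
    (hzs : ∀ i, z i ∈ s) (hfz : ∀ i, f (z i) = 0) :
    ∃ w : Fin n → ℝ, StrictMono w ∧
      ∀ i, w i ∈ Set.Ioo (z i.castSucc) (z i.succ) ∧ f' (w i) = 0 := by
  have rolle (i : Fin n) : ∃ x ∈ Set.Ioo (z i.castSucc) (z i.succ), f' x = 0 := by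
    have hsub : Set.Icc (z i.castSucc) (z i.succ) ⊆ s := Set.Icc_subset s (hzs _) (hzs _)
    exact exists_hasDerivAt_eq_zero (hz i.castSucc_lt_succ)
      (fun x hx => (hf x (hsub hx)).continuousAt.continuousWithinAt)
      (by rw [hfz, hfz]) (fun x hx => hf x (hsub (Set.Ioo_subset_Icc_self hx)))
  choose w hw hw' using rolle
  refine ⟨w, fun i j hij => ?_, fun i => ⟨hw i, hw' i⟩⟩
  calc w i < z i.succ := (hw i).2
    _ ≤ z j.castSucc := hz.monotone (Fin.succ_le_castSucc_iff.2 hij)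
    _ < w j := (hw j).1

theorem hasDerivAt_arctanh_s6 {x : ℝ} (hx : x ∈ Set.Ioo (-1 : ℝ) 1) :
    HasDerivAt arctanh (1 / (1 - x ^ 2)) x := by
  have h₁ : 1 + x ≠ 0 := by linarith [hx.1]
  have h₂ : 1 - x ≠ 0 := by linarith [hx.2]
  have h₃ : 1 - x ^ 2 ≠ 0 := by
    rw [show 1 - x ^ 2 = (1 + x) * (1 - x) by ring]
    exact mul_ne_zero h₁ h₂
  have h := (((((hasDerivAt_id x).const_add 1).div ((hasDerivAt_id x).const_sub 1) h₂).log
    (div_ne_zero h₁ h₂)).const_mul (1 / 2))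
  refine HasDerivAt.congr_deriv (f := arctanh) h ?_
  simp only [id, Pi.div_apply]
  field_simp
  ring

/-- The numerator of the derivative of
`(a r + b r² + c r³ + d r⁴) / (r² - 1)² + α arctanh r` over `(r² - 1)³`. -/
noncomputable def derivNumerator (a b c d α : ℝ) : Polynomial ℝ :=
  Polynomial.C (-c - α) * Polynomial.X ^ 4 + Polynomial.C (-2 * b - 4 * d) * Polynomial.X ^ 3 +
    Polynomial.C (-3 * a - 3 * c + 2 * α) * Polynomial.X ^ 2 +
    Polynomial.C (-2 * b) * Polynomial.X + Polynomial.C (-a - α)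

theorem natDegree_derivNumerator_le (a b c d α : ℝ) :
    (derivNumerator a b c d α).natDegree ≤ 4 := by
  unfold derivNumerator
  compute_degree

theorem derivNumerator_ne_zero {a b c d α : ℝ}
    (hne : ¬ (a = 0 ∧ b = 0 ∧ c = 0 ∧ d = 0 ∧ α = 0)) : derivNumerator a b c d α ≠ 0 := by
  intro h
  have hcoeff (k : ℕ) : (derivNumerator a b c d α).coeff k = 0 := by rw [h, Polynomial.coeff_zero]
  have h0 := hcoeff 0
  have h1 := hcoeff 1
  have h2 := hcoeff 2
  have h3 := hcoeff 3
  have h4 := hcoeff 4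
  simp [derivNumerator, Polynomial.coeff_X, Polynomial.coeff_C, -map_sub, -map_add, -map_mul,
    -map_neg] at h0 h1 h2 h3 h4
  refine hne ⟨?_, ?_, ?_, ?_, ?_⟩ <;> linarith

theorem hasDerivAt_div_add_arctanh (a b c d α : ℝ) {x : ℝ} (hx : x ∈ Set.Ioo (-1 : ℝ) 1) :
    HasDerivAt
      (fun r => (a * r + b * r ^ 2 + c * r ^ 3 + d * r ^ 4) / (r ^ 2 - 1) ^ 2 + α * arctanh r)
      ((derivNumerator a b c d α).eval x / (x ^ 2 - 1) ^ 3) x := by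
  have hne : x ^ 2 - 1 ≠ 0 := by nlinarith [hx.1, hx.2]
  have hne' : 1 - x ^ 2 ≠ 0 := by rwa [← neg_sub, neg_ne_zero]
  have hnum := ((((hasDerivAt_id x).const_mul a).add ((hasDerivAt_pow 2 x).const_mul b)).add
    ((hasDerivAt_pow 3 x).const_mul c)).add ((hasDerivAt_pow 4 x).const_mul d)
  have hden := ((hasDerivAt_pow 2 x).sub_const 1).pow 2
  have h := (hnum.div hden (pow_ne_zero 2 hne)).add ((hasDerivAt_arctanh_s6 hx).const_mul α)
  refine h.congr_deriv ?_
  simp [derivNumerator, -map_sub, -map_add, -map_mul, -map_neg]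
  field_simp
  ring

/-- Any nonzero element of the span of `[r, r², r³, r⁴, (r²−1)²·arctanh r]`
has at most 4 zeros in `(0,1)`. -/
theorem span_F1_at_most_four_zeros (a b c d α : ℝ)
    (hne : ¬ (a = 0 ∧ b = 0 ∧ c = 0 ∧ d = 0 ∧ α = 0)) :
    {r ∈ Set.Ioo (0:ℝ) 1 |
        a * r + b * r ^ 2 + c * r ^ 3 + d * r ^ 4 +
          α * (r ^ 2 - 1) ^ 2 * arctanh r = 0}.encard ≤ 4 := by
  by_contra! hlt
  have hfive : (5 : ℕ∞) ≤ _ := Order.add_one_le_of_lt hlt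
  obtain ⟨t, ht, htcard⟩ := Set.exists_subset_encard_eq hfive
  have htfin : t.Finite := Set.finite_of_encard_eq_coe (k := 5) htcard
  lift t to Finset ℝ using htfin
  rw [Set.encard_coe_eq_coe_finsetCard] at htcard
  have h0 : (0 : ℝ) ∉ t := fun h => lt_irrefl _ (ht h).1.1
  have hcard : (insert 0 t).card = 5 + 1 := by
    rw [Finset.card_insert_of_notMem h0, show t.card = 5 from mod_cast htcard]
  have hmem (i : Fin (5 + 1)) := Finset.orderEmbOfFin_mem (insert 0 t) hcard i
  have hIco (i : Fin (5 + 1)) : (insert 0 t).orderEmbOfFin hcard i ∈ Set.Ico (0 : ℝ) 1 := by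
    rcases Finset.mem_insert.1 (hmem i) with h | h
    · simp [h]
    · exact Set.Ioo_subset_Ico_self (ht h).1
  obtain ⟨w, hw, hw'⟩ := exists_strictMono_hasDerivAt_eq_zero
    (fun x hx => hasDerivAt_div_add_arctanh a b c d α hx)
    ((insert 0 t).orderEmbOfFin hcard).strictMono
    (fun i => ⟨by linarith [(hIco i).1], (hIco i).2⟩)
    (fun i => by
      rcases Finset.mem_insert.1 (hmem i) with h | h
      · simp [h, arctanh]
      · obtain ⟨⟨hpos, hlt_one⟩, hzero⟩ := ht h
        have hden : ((insert 0 t).orderEmbOfFin hcard i) ^ 2 - 1 ≠ 0 := by nlinarith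
        field_simp
        linarith)
  have hroots : (Finset.univ.image w).val ⊆ (derivNumerator a b c d α).roots := by
    intro x hx
    rw [Finset.mem_val] at hx
    obtain ⟨i, -, rfl⟩ := Finset.mem_image.1 hx
    have hpos := (hIco _).1.trans_lt (hw' i).1.1
    have hlt_one := (hw' i).1.2.trans (hIco _).2
    have hden : w i ^ 2 - 1 ≠ 0 := by nlinarith
    rw [Polynomial.mem_roots (derivNumerator_ne_zero hne)]
    exact (div_eq_zero_iff.1 (hw' i).2).resolve_right (pow_ne_zero 3 hden)
  have hdeg := Polynomial.card_le_degree_of_subset_roots hroots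
  rw [Finset.card_image_of_injective _ hw.injective, Finset.card_univ, Fintype.card_fin] at hdeg
  exact (natDegree_derivNumerator_le a b c d α).not_gt hdeg
end

section
/- For every r ∈ (0,1), one has r·(5r² − 3) + 3·(r²−1)²·arctanh r > 0. -/
/-- Positivity of (the transcendental factor of) the Wronskian `W₄` on `(0,1)`. -/
theorem W4_pos (r : ℝ) (hr : r ∈ Set.Ioo (0:ℝ) 1) :
    r * (5 * r ^ 2 - 3) + 3 * (r ^ 2 - 1) ^ 2 * arctanh r > 0 := by
  obtain ⟨h0, h1⟩ := hr
  have harctanh : r + r ^ 3 / 3 + r ^ 5 / 5 ≤ arctanh r := by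
    have h := Real.sum_range_le_log_div h0.le h1 3
    norm_num [Finset.sum_range_succ] at h
    unfold arctanh
    linarith
  have hpoly : 0 < r ^ 5 * (8 - r ^ 2 + 3 * r ^ 4) / 5 := by
    have : 0 < 8 - r ^ 2 + 3 * r ^ 4 := by nlinarith [pow_pos h0 4]
    positivity
  calc
    0 < r ^ 5 * (8 - r ^ 2 + 3 * r ^ 4) / 5 := hpoly
    _ = r * (5 * r ^ 2 - 3) + 3 * (r ^ 2 - 1) ^ 2 * (r + r ^ 3 / 3 + r ^ 5 / 5) := by ring
    _ ≤ r * (5 * r ^ 2 - 3) + 3 * (r ^ 2 - 1) ^ 2 * arctanh r := by gcongr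
end

section
/- For every r ∈ (0,1), one has −15r + 22r³ − 3r⁵ + 3·(r²−1)²·(5 + r²)·arctanh r > 0. -/
/-- Positivity of (the transcendental factor of) the Wronskian `W₅` on `(0,1)`. -/
theorem W5_pos (r : ℝ) (hr : r ∈ Set.Ioo (0:ℝ) 1) :
    -15 * r + 22 * r ^ 3 - 3 * r ^ 5 + 3 * (r ^ 2 - 1) ^ 2 * (5 + r ^ 2) * arctanh r > 0 := by
  obtain ⟨h0, h1⟩ := hr
  have hser : r + r ^ 3 / 3 + r ^ 5 / 5 ≤ arctanh r := by
    have h := Real.sum_range_le_log_div h0.le h1 3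
    norm_num [Finset.sum_range_succ] at h
    unfold arctanh
    linarith
  have hmul := mul_le_mul_of_nonneg_left hser
    (by positivity : (0 : ℝ) ≤ 3 * (r ^ 2 - 1) ^ 2 * (5 + r ^ 2))
  have hpos : 0 < 3 / 5 * r ^ 7 + 14 / 5 * r ^ 9 + 3 / 5 * r ^ 11 := by positivity
  linarith
end

section
/- Let a, b be real numbers, not both zero, and consider the real polynomials p(x) = a + b·x − a·x² and q(x) = −a + b·x + a·x². Then the number of zeros of p in the open interval (0,1), counted with multiplicity, plus the number of zeros of q in (0,1), counted with multiplicity, is at most 1. -/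
open Polynomial

open scoped Classical in
/-- The number of zeros of a real polynomial in the open interval `(0,1)`,
counted with multiplicity. -/
noncomputable def numZerosIn01 (p : Polynomial ℝ) : ℕ :=
  (p.roots.filter (fun x => x ∈ Set.Ioo (0:ℝ) 1)).card

theorem numZerosIn01_le_one (a b : ℝ) (hne : ¬ (a = 0 ∧ b = 0)) :
    numZerosIn01 (C a + C b * X - C a * X ^ 2) ≤ 1 := by
  classical
  by_contra! hlt
  obtain ⟨x, hx⟩ := Multiset.card_pos_iff_exists_mem.mp (zero_lt_one.trans hlt)
  obtain ⟨hroot, hx0, hx1⟩ := Multiset.mem_filter.mp hx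
  have heval : a + b * x - a * x ^ 2 = 0 := by
    simpa using (mem_roots'.mp hroot).2
  have ha : a ≠ 0 := by
    rintro rfl
    exact hne ⟨rfl, by simpa [hx0.ne'] using heval⟩
  have hb : b = -a * (x⁻¹ - x) := by
    field_simp
    linarith
  have hfac : C a + C b * X - C a * X ^ 2 = C (-a) * ((X - C x) * (X - C (-x⁻¹))) := by
    have hinv : (C x * C x⁻¹ : ℝ[X]) = 1 := by
      rw [← C_mul, mul_inv_cancel₀ hx0.ne', C_1]
    rw [hb]
    simp only [C_mul, C_neg, C_sub]
    linear_combination (-C a) * hinv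
  have hneg : ¬ -x⁻¹ ∈ Set.Ioo (0 : ℝ) 1 := fun h =>
    absurd h.1 (by simpa using hx0.le)
  have hroots : (C a + C b * X - C a * X ^ 2).roots = {x} + {-x⁻¹} := by
    rw [hfac, roots_C_mul _ (neg_ne_zero.mpr ha),
      roots_mul (mul_ne_zero (X_sub_C_ne_zero _) (X_sub_C_ne_zero _)),
      roots_X_sub_C, roots_X_sub_C]
  refine hlt.ne' ?_
  rw [numZerosIn01, hroots, Multiset.filter_add, Multiset.filter_singleton,
    Multiset.filter_singleton, if_pos ⟨hx0, hx1⟩, if_neg hneg]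
  simp

theorem mul_neg_of_numZerosIn01_pos {a b : ℝ} (hne : ¬ (a = 0 ∧ b = 0))
    (h : 0 < numZerosIn01 (C a + C b * X - C a * X ^ 2)) : a * b < 0 := by
  classical
  obtain ⟨x, hx⟩ := Multiset.card_pos_iff_exists_mem.mp h
  obtain ⟨hroot, hx0, hx1⟩ := Multiset.mem_filter.mp hx
  have heval : a + b * x - a * x ^ 2 = 0 := by
    simpa using (mem_roots'.mp hroot).2
  have ha : a ≠ 0 := by
    rintro rfl
    exact hne ⟨rfl, by simpa [hx0.ne'] using heval⟩
  have hprod : a * b * x = -(a ^ 2 * (1 - x ^ 2)) := by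
    linear_combination a * heval
  have hpos : 0 < a ^ 2 * (1 - x ^ 2) :=
    mul_pos (by positivity) (by nlinarith)
  exact neg_of_mul_neg_left (by linarith) hx0.le

/-- For `a, b` not both zero, `p(x) = a + bx − ax²` and `q(x) = −a + bx + ax²` have
at most 1 zero in `(0,1)` in total, counted with multiplicity. -/
theorem zeros_m0 (a b : ℝ) (hne : ¬ (a = 0 ∧ b = 0)) :
    numZerosIn01 (C a + C b * X - C a * X ^ 2) +
      numZerosIn01 (-C a + C b * X + C a * X ^ 2) ≤ 1 := by
  have hne' : ¬ (-a = 0 ∧ b = 0) := by simpa using hne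
  have hq : -C a + C b * X + C a * X ^ 2 = C (-a) + C b * X - C (-a) * X ^ 2 := by
    rw [C_neg]
    ring
  rw [hq]
  have hp1 := numZerosIn01_le_one a b hne
  have hq1 := numZerosIn01_le_one (-a) b hne'
  by_contra! hlt
  have hab := mul_neg_of_numZerosIn01_pos hne (by omega)
  have hab' := mul_neg_of_numZerosIn01_pos hne' (by omega)
  linarith
end

section
/- Let a, b, c, d be real numbers, not all zero, and consider the real polynomials p(x) = a + b·x + c·x² + d·x³ and q(x) = c + (b + 2d)·x + a·x² − d·x³. Then the number of zeros of p in the open interval (0,1), counted with multiplicity, plus the number of zeros of q in (0,1), counted with multiplicity, is at most 4. -/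
open Polynomial

theorem numZerosIn01_le_natDegree (p : ℝ[X]) : numZerosIn01 p ≤ p.natDegree :=
  (Multiset.card_le_card (Multiset.filter_le _ _)).trans (card_roots' p)

theorem exists_multiset_of_le_numZerosIn01 {p : ℝ[X]} (hp : p ≠ 0) {n : ℕ}
    (h : n ≤ numZerosIn01 p) :
    ∃ s : Multiset ℝ, s.card = n ∧ (∀ x ∈ s, x ∈ Set.Ioo (0 : ℝ) 1) ∧
      (s.map fun x => X - C x).prod ∣ p := by
  classical
  obtain ⟨s, hs⟩ := Multiset.card_pos_iff_exists_mem.1 <| by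
    rw [Multiset.card_powersetCard]
    exact Nat.choose_pos h
  obtain ⟨hs, hcard⟩ := Multiset.mem_powersetCard.1 hs
  refine ⟨s, hcard, fun x hx => (Multiset.mem_filter.1 (Multiset.mem_of_le hs hx)).2, ?_⟩
  exact (Multiset.prod_X_sub_C_dvd_iff_le_roots hp s).2 (hs.trans (Multiset.filter_le _ _))

theorem exists_factor_of_two_le_numZerosIn01 {p : ℝ[X]} (hp : p ≠ 0) (hd : p.natDegree ≤ 3)
    (h : 2 ≤ numZerosIn01 p) :
    ∃ x ∈ Set.Ioo (0 : ℝ) 1, ∃ y ∈ Set.Ioo (0 : ℝ) 1, ∃ e f : ℝ,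
      p = (X - C x) * (X - C y) * (C f * X + C e) := by
  obtain ⟨s, hs, hmem, r, rfl⟩ := exists_multiset_of_le_numZerosIn01 hp h
  obtain ⟨x, y, rfl⟩ := Multiset.card_eq_two.1 hs
  have hr : r.natDegree ≤ 1 := by
    rw [natDegree_mul (left_ne_zero_of_mul hp) (right_ne_zero_of_mul hp),
      natDegree_multiset_prod_X_sub_C_eq_card, hs] at hd
    omega
  obtain ⟨f, e, rfl⟩ := exists_eq_X_add_C_of_natDegree_le_one hr
  exact ⟨x, hmem x (by simp), y, hmem y (by simp), e, f, by simp⟩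

theorem exists_factor_of_three_le_numZerosIn01 {p : ℝ[X]} (hp : p ≠ 0) (hd : p.natDegree ≤ 3)
    (h : 3 ≤ numZerosIn01 p) :
    ∃ x ∈ Set.Ioo (0 : ℝ) 1, ∃ y ∈ Set.Ioo (0 : ℝ) 1, ∃ z ∈ Set.Ioo (0 : ℝ) 1, ∃ k : ℝ,
      p = (X - C x) * (X - C y) * (X - C z) * C k := by
  obtain ⟨s, hs, hmem, r, rfl⟩ := exists_multiset_of_le_numZerosIn01 hp h
  obtain ⟨x, y, z, rfl⟩ := Multiset.card_eq_three.1 hs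
  have hr : r.natDegree = 0 := by
    rw [natDegree_mul (left_ne_zero_of_mul hp) (right_ne_zero_of_mul hp),
      natDegree_multiset_prod_X_sub_C_eq_card, hs] at hd
    omega
  obtain ⟨k, rfl⟩ := natDegree_eq_zero.1 hr
  exact ⟨x, hmem x (by simp), y, hmem y (by simp), z, hmem z (by simp), k, by
    simp [mul_assoc]⟩

theorem numZerosIn01_le_one_of_three_le {a b c d : ℝ} {p q : ℝ[X]} (hp0 : p ≠ 0) (hq0 : q ≠ 0)
    (hpd : p.natDegree ≤ 3) (hqd : q.natDegree ≤ 3)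
    (hp : ∀ x, p.eval x = a + b * x + c * x ^ 2 + d * x ^ 3)
    (hq : ∀ x, q.eval x = c + (b + 2 * d) * x + a * x ^ 2 - d * x ^ 3)
    (h : 3 ≤ numZerosIn01 p) : numZerosIn01 q ≤ 1 := by
  by_contra! h2
  obtain ⟨x, ⟨hx0, hx1⟩, y, ⟨hy0, hy1⟩, z, ⟨hz0, hz1⟩, k, rfl⟩ :=
    exists_factor_of_three_le_numZerosIn01 hp0 hpd h
  obtain ⟨u, ⟨hu0, hu1⟩, v, ⟨hv0, hv1⟩, e, f, rfl⟩ :=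
    exists_factor_of_two_le_numZerosIn01 hq0 hqd h2
  have hk : k ≠ 0 := by
    rintro rfl
    simp at hp0
  simp only [eval_mul, eval_sub, eval_add, eval_X, eval_C] at hp hq
  have hdk : d = k := by
    linear_combination (-hp 2 + 3 * hp 1 - 3 * hp 0 + hp (-1)) / 6
  have hc : c = -k * (x + y + z) := by
    linear_combination -(hp 1 + hp (-1) - 2 * hp 0) / 2
  have hf : f = -k := by
    linear_combination (hq 2 - 3 * hq 1 + 3 * hq 0 - hq (-1)) / 6 - hdk
  have hce : u * v * (k * e) = -(k ^ 2 * (x + y + z)) := by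
    linear_combination k * hq 0 + k * hc
  have hone : (1 - u) * (1 - v) * (k * e - k ^ 2) =
      k ^ 2 * ((1 - x) * (1 - y) * (1 - z)) := by
    linear_combination k * hq 1 - k * hp 1 - k * (1 - u) * (1 - v) * hf
  have hk2 : 0 < k ^ 2 := by positivity
  have hke : k * e < 0 := by
    have : 0 < k ^ 2 * (x + y + z) := by positivity
    have huv : 0 < u * v := by positivity
    by_contra! hcon
    linarith [mul_nonneg huv.le hcon]
  have hleft : (1 - u) * (1 - v) * (k * e - k ^ 2) < 0 :=
    mul_neg_of_pos_of_neg (mul_pos (by linarith) (by linarith)) (by linarith)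
  have hright : 0 < k ^ 2 * ((1 - x) * (1 - y) * (1 - z)) :=
    mul_pos hk2 (mul_pos (mul_pos (by linarith) (by linarith)) (by linarith))
  linarith

theorem eq_zero_of_cubic_eval_eq_zero {a b c d : ℝ}
    (h : ∀ x : ℝ, a + b * x + c * x ^ 2 + d * x ^ 3 = 0) :
    a = 0 ∧ b = 0 ∧ c = 0 ∧ d = 0 := by
  have h0 := h 0
  have h1 := h 1
  have h2 := h (-1)
  have h3 := h 2
  norm_num at h0 h1 h2 h3
  refine ⟨?_, ?_, ?_, ?_⟩ <;> linarith

/-- For `a, b, c, d` not all zero, `p(x) = a + bx + cx² + dx³` and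
`q(x) = c + (b+2d)x + ax² − dx³` have at most 4 zeros in `(0,1)` in total,
counted with multiplicity. -/
theorem zeros_m1 (a b c d : ℝ) (hne : ¬ (a = 0 ∧ b = 0 ∧ c = 0 ∧ d = 0)) :
    numZerosIn01 (C a + C b * X + C c * X ^ 2 + C d * X ^ 3) +
      numZerosIn01 (C c + C (b + 2 * d) * X + C a * X ^ 2 - C d * X ^ 3) ≤ 4 := by
  set p : ℝ[X] := C a + C b * X + C c * X ^ 2 + C d * X ^ 3 with hp_def
  set q : ℝ[X] := C c + C (b + 2 * d) * X + C a * X ^ 2 - C d * X ^ 3 with hq_def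
  have hp : ∀ x, p.eval x = a + b * x + c * x ^ 2 + d * x ^ 3 := by
    intro x
    simp [hp_def]
  have hq : ∀ x, q.eval x = c + (b + 2 * d) * x + a * x ^ 2 - d * x ^ 3 := by
    intro x
    simp [hq_def]
  have hpd : p.natDegree ≤ 3 := by
    rw [hp_def]
    compute_degree
  have hqd : q.natDegree ≤ 3 := by
    rw [hq_def]
    compute_degree
  have hp0 : p ≠ 0 := fun h0 =>
    hne (eq_zero_of_cubic_eval_eq_zero fun x => by rw [← hp, h0, eval_zero])
  have hq0 : q ≠ 0 := by
    intro h0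
    obtain ⟨hc, hb, ha, hd⟩ := eq_zero_of_cubic_eval_eq_zero
      (a := c) (b := b + 2 * d) (c := a) (d := -d) fun x => by
        have := hq x
        rw [h0, eval_zero] at this
        linarith
    exact hne ⟨ha, by linarith, hc, by linarith⟩
  have hpq := numZerosIn01_le_one_of_three_le hp0 hq0 hpd hqd hp hq
  have hqp := numZerosIn01_le_one_of_three_le (a := c) (b := b + 2 * d) (c := a) (d := -d)
    hq0 hp0 hqd hpd (fun x => by rw [hq]; ring) (fun x => by rw [hp]; ring)
  have hp3 := (numZerosIn01_le_natDegree p).trans hpd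
  have hq3 := (numZerosIn01_le_natDegree q).trans hqd
  omega
end

section
/- Let a, b, c, d, κ be real numbers and consider the real polynomials p(x) = a + b·x + c·x² + d·x³ and q(x) = c + (b + 2d − κ)·x + a·x² + (κ − d)·x³, and assume p ≠ 0 and q ≠ 0. Then the number of zeros of p in the open interval (0,1), counted with multiplicity, plus the number of zeros of q in (0,1), counted with multiplicity, is at most 4. -/
open Polynomial

/-- A polynomial with at least `n` zeros in `(0,1)` splits off `n` linear factors with roots there. -/
lemma exists_eq_prod_mul_of_le_numZerosIn01 {p : ℝ[X]} (hp : p ≠ 0) {n : ℕ}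
    (hn : n ≤ numZerosIn01 p) :
    ∃ (s : Multiset ℝ) (g : ℝ[X]), s.card = n ∧ (∀ x ∈ s, x ∈ Set.Ioo (0 : ℝ) 1) ∧
      p = (s.map (fun x => X - C x)).prod * g ∧ n + g.natDegree = p.natDegree := by
  classical
  obtain ⟨s, hmem⟩ := Multiset.card_pos_iff_exists_mem.1
    ((Nat.choose_pos hn).trans_eq (Multiset.card_powersetCard n _).symm)
  obtain ⟨hs, rfl⟩ := Multiset.mem_powersetCard.1 hmem
  obtain ⟨g, hg⟩ := (Multiset.prod_X_sub_C_dvd_iff_le_roots hp s).2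
    (hs.trans (Multiset.filter_le _ _))
  refine ⟨s, g, rfl, fun x hx => ?_, hg, ?_⟩
  · have := Multiset.mem_of_le hs hx
    rw [Multiset.mem_filter] at this
    exact this.2
  · have hg0 : g ≠ 0 := by
      rintro rfl
      exact hp (by simpa using hg)
    rw [hg, natDegree_mul (monic_multiset_prod_of_monic _ _ fun x _ => monic_X_sub_C x).ne_zero hg0,
      natDegree_multiset_prod_X_sub_C_eq_card]

lemma natDegree_cubic_poly_le (a b c d : ℝ) :
    (C a + C b * X + C c * X ^ 2 + C d * X ^ 3).natDegree ≤ 3 := by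
  compute_degree

lemma numZerosIn01_cubic_le (a b c d : ℝ) :
    numZerosIn01 (C a + C b * X + C c * X ^ 2 + C d * X ^ 3) ≤ 3 := by
  classical
  exact (Multiset.card_le_card (Multiset.filter_le _ _)).trans
    ((card_roots' _).trans (natDegree_cubic_poly_le a b c d))

/-- The constant coefficient of `α (x - r) (x - s) (x - t)` with `r`, `s`, `t` in `(0,1)` is smaller
in absolute value than its quadratic coefficient. -/
lemma sq_mul_lt_sq_mul_of_mem_Ioo {α r s t : ℝ} (hα : α ≠ 0) (hr : r ∈ Set.Ioo (0 : ℝ) 1)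
    (hs : s ∈ Set.Ioo (0 : ℝ) 1) (ht : t ∈ Set.Ioo (0 : ℝ) 1) :
    (-(α * (r * s * t))) ^ 2 < (-(α * (r + s + t))) ^ 2 := by
  obtain ⟨hr0, hr1⟩ := hr
  obtain ⟨hs0, hs1⟩ := hs
  obtain ⟨ht0, ht1⟩ := ht
  have h : r * s * t < r + s + t := by
    have h1 : r * s < 1 := mul_lt_one_of_nonneg_of_lt_one_left hr0.le hr1 hs1.le
    nlinarith
  have h2 : (r * s * t) ^ 2 < (r + s + t) ^ 2 := pow_lt_pow_left₀ h (by positivity) two_ne_zero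
  rw [neg_sq, neg_sq, mul_pow α, mul_pow α]
  exact mul_lt_mul_of_pos_left h2 (sq_pos_of_ne_zero hα)

lemma cubic_signs_of_three_le_numZerosIn01 {a b c d : ℝ}
    (hp : C a + C b * X + C c * X ^ 2 + C d * X ^ 3 ≠ 0)
    (h : 3 ≤ numZerosIn01 (C a + C b * X + C c * X ^ 2 + C d * X ^ 3)) :
    c * (a + b + c + d) < 0 ∧ a ^ 2 < c ^ 2 := by
  obtain ⟨m, g, hm, hmem, hg, hdeg⟩ := exists_eq_prod_mul_of_le_numZerosIn01 hp h
  have hd := natDegree_cubic_poly_le a b c d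
  obtain ⟨α, rfl⟩ := natDegree_eq_zero.1 (show g.natDegree = 0 by omega)
  obtain ⟨r, s, t, rfl⟩ := Multiset.card_eq_three.1 hm
  have hr := hmem r (by simp)
  have hs := hmem s (by simp)
  have ht := hmem t (by simp)
  have hα : α ≠ 0 := by
    rintro rfl
    exact hp (by simpa using hg)
  have e0 := congrArg (eval 0) hg
  have e1 := congrArg (eval 1) hg
  have e2 := congrArg (eval (-1)) hg
  simp at e0 e1 e2
  have ha : a = -(α * (r * s * t)) := by linear_combination e0
  have hc : c = -(α * (r + s + t)) := by linear_combination (e1 + e2) / 2 - e0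
  have hS : a + b + c + d = α * ((1 - r) * (1 - s) * (1 - t)) := by linear_combination e1
  have hαα : 0 < α ^ 2 := by positivity
  have hP : 0 < (1 - r) * (1 - s) * (1 - t) :=
    mul_pos (mul_pos (sub_pos.2 hr.2) (sub_pos.2 hs.2)) (sub_pos.2 ht.2)
  rw [hS]
  refine ⟨?_, ?_⟩
  · have := mul_pos (mul_pos hαα (add_pos (add_pos hr.1 hs.1) ht.1)) hP
    rw [hc]
    linarith
  · rw [ha, hc]
    exact sq_mul_lt_sq_mul_of_mem_Ioo hα hr hs ht

/-- If a cubic changes sign between `0` and `1` and has two zeros in `(0,1)`, it has a third, so its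
constant coefficient is smaller in absolute value than its quadratic coefficient. -/
lemma sq_lt_sq_of_two_le_numZerosIn01 {a b c d : ℝ}
    (hp : C a + C b * X + C c * X ^ 2 + C d * X ^ 3 ≠ 0)
    (h : 2 ≤ numZerosIn01 (C a + C b * X + C c * X ^ 2 + C d * X ^ 3))
    (hsign : a * (a + b + c + d) < 0) : a ^ 2 < c ^ 2 := by
  obtain ⟨m, g, hm, hmem, hg, hdeg⟩ := exists_eq_prod_mul_of_le_numZerosIn01 hp h
  have hd := natDegree_cubic_poly_le a b c d
  obtain ⟨α, β, rfl⟩ := exists_eq_X_add_C_of_natDegree_le_one (show g.natDegree ≤ 1 by omega)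
  obtain ⟨r, s, rfl⟩ := Multiset.card_eq_two.1 hm
  have hr := hmem r (by simp)
  have hs := hmem s (by simp)
  have e0 := congrArg (eval 0) hg
  have e1 := congrArg (eval 1) hg
  have e2 := congrArg (eval (-1)) hg
  simp at e0 e1 e2
  have ha : a = r * s * β := by linear_combination e0
  have hc : c = β - α * (r + s) := by linear_combination (e1 + e2) / 2 - e0
  have hS : a + b + c + d = (1 - r) * (1 - s) * (α + β) := by linear_combination e1
  have hβ : β * (α + β) < 0 := by
    have hP : 0 < r * s * ((1 - r) * (1 - s)) :=
      mul_pos (mul_pos hr.1 hs.1) (mul_pos (sub_pos.2 hr.2) (sub_pos.2 hs.2))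
    refine neg_of_mul_neg_right (a := r * s * ((1 - r) * (1 - s))) ?_ hP.le
    rw [hS, ha] at hsign
    linarith
  have hα : α ≠ 0 := by
    rintro rfl
    nlinarith [sq_nonneg β]
  have ht : -β / α ∈ Set.Ioo (0 : ℝ) 1 := by
    have hαα : 0 < α ^ 2 := by positivity
    have hβ0 : β ≠ 0 := by
      rintro rfl
      simp at hβ
    have hsum : α + β ≠ 0 := by
      intro h0
      simp [h0] at hβ
    have hββ : 0 < β ^ 2 := by positivity
    have hss : 0 < (α + β) ^ 2 := by positivity
    have e : -β / α = -(α * β) / α ^ 2 := by field_simp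
    rw [e]
    exact ⟨div_pos (by nlinarith) hαα, (div_lt_one hαα).2 (by nlinarith)⟩
  have key := sq_mul_lt_sq_mul_of_mem_Ioo hα hr hs ht
  convert key using 2
  · rw [ha]
    field_simp
  · rw [hc]
    field_simp
    ring

/-- For nonzero `p(x) = a + bx + cx² + dx³` and `q(x) = c + (b+2d−κ)x + ax² + (κ−d)x³`,
they have at most 4 zeros in `(0,1)` in total, counted with multiplicity. -/
theorem zeros_m2 (a b c d κ : ℝ)
    (hp : C a + C b * X + C c * X ^ 2 + C d * X ^ 3 ≠ 0)
    (hq : C c + C (b + 2 * d - κ) * X + C a * X ^ 2 + C (κ - d) * X ^ 3 ≠ 0) :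
    numZerosIn01 (C a + C b * X + C c * X ^ 2 + C d * X ^ 3) +
      numZerosIn01 (C c + C (b + 2 * d - κ) * X + C a * X ^ 2 + C (κ - d) * X ^ 3) ≤ 4 := by
  have hp3 := numZerosIn01_cubic_le a b c d
  have hq3 := numZerosIn01_cubic_le c (b + 2 * d - κ) a (κ - d)
  have hS : c + (b + 2 * d - κ) + a + (κ - d) = a + b + c + d := by ring
  by_contra! h
  rcases le_or_gt 3 (numZerosIn01 (C a + C b * X + C c * X ^ 2 + C d * X ^ 3)) with h3 | h3
  · obtain ⟨h2, h3⟩ := cubic_signs_of_three_le_numZerosIn01 hp h3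
    exact lt_asymm h3 (sq_lt_sq_of_two_le_numZerosIn01 hq (by omega) (by rwa [hS]))
  · obtain ⟨h2, h3⟩ := cubic_signs_of_three_le_numZerosIn01 hq (by omega)
    exact lt_asymm h3 (sq_lt_sq_of_two_le_numZerosIn01 hp (by omega) (by rwa [hS] at h2))
end

section
/- Let r₁, r₂, r₃ ∈ (0,1) and define the cubic polynomial Q(x) = −x³ − (r₁r₂r₃)·x² + (r₁r₂ + r₁r₃ + r₂r₃ + 2)·x − (r₁ + r₂ + r₃). Then Q has exactly one zero in the open interval (0,1), and this zero is simple (i.e., Q does not vanish to order greater than one there). -/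
/-- If `t ↦ -t³ - p t² + b t - c` vanishes at `x < 1` and is positive at `1`, then its chord
from `x` to `1` has positive slope. -/
lemma chord_slope_pos_of_zero {p b c x : ℝ} (hx : x < 1)
    (h0 : -x ^ 3 - p * x ^ 2 + b * x - c = 0) (h1 : 0 < -1 - p + b - c) :
    0 < b - (1 + x + x ^ 2) - p * (1 + x) := by
  refine pos_of_mul_pos_right (a := 1 - x) ?_ (by linarith)
  linarith

/-- A cubic `t ↦ -t³ - p t² + b t - c` with `p ≥ 0` which is positive at `1` has at most one zero
in `(0,1)`. -/
lemma zero_unique_of_pos_at_one {p b c x y : ℝ} (hp : 0 ≤ p) (hx : x ∈ Set.Ioo (0 : ℝ) 1)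
    (hy : y ∈ Set.Ioo (0 : ℝ) 1) (hx0 : -x ^ 3 - p * x ^ 2 + b * x - c = 0)
    (hy0 : -y ^ 3 - p * y ^ 2 + b * y - c = 0) (h1 : 0 < -1 - p + b - c) : y = x := by
  have hs := chord_slope_pos_of_zero hx.2 hx0 h1
  have hxy : (y - x) * (b - (y ^ 2 + x * y + x ^ 2) - p * (x + y)) = 0 := by linarith
  rcases mul_eq_zero.mp hxy with h | h
  · linarith
  · have hpy : 0 ≤ p * (1 - y) := mul_nonneg hp (by linarith [hy.2])
    have hxy' : 0 < x * (1 - y) := mul_pos hx.1 (by linarith [hy.2])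
    nlinarith [hy.1, hy.2]


/-- For `r₁, r₂, r₃ ∈ (0,1)`, the cubic
`Q(x) = −x³ − r₁r₂r₃·x² + (r₁r₂ + r₁r₃ + r₂r₃ + 2)·x − (r₁ + r₂ + r₃)`
has exactly one zero in `(0,1)`, and it is simple. -/
theorem cubic_unique_simple_zero (r₁ r₂ r₃ : ℝ)
    (h₁ : r₁ ∈ Set.Ioo (0:ℝ) 1) (h₂ : r₂ ∈ Set.Ioo (0:ℝ) 1) (h₃ : r₃ ∈ Set.Ioo (0:ℝ) 1) :
    ∃ x ∈ Set.Ioo (0:ℝ) 1,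
      (fun t : ℝ => -t ^ 3 - r₁ * r₂ * r₃ * t ^ 2 + (r₁ * r₂ + r₁ * r₃ + r₂ * r₃ + 2) * t -
        (r₁ + r₂ + r₃)) x = 0 ∧
      deriv (fun t : ℝ => -t ^ 3 - r₁ * r₂ * r₃ * t ^ 2 +
        (r₁ * r₂ + r₁ * r₃ + r₂ * r₃ + 2) * t - (r₁ + r₂ + r₃)) x ≠ 0 ∧
      ∀ y ∈ Set.Ioo (0:ℝ) 1,
        (fun t : ℝ => -t ^ 3 - r₁ * r₂ * r₃ * t ^ 2 + (r₁ * r₂ + r₁ * r₃ + r₂ * r₃ + 2) * t -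
          (r₁ + r₂ + r₃)) y = 0 → y = x := by
  obtain ⟨a₁, b₁⟩ := h₁
  obtain ⟨a₂, b₂⟩ := h₂
  obtain ⟨a₃, b₃⟩ := h₃
  have hp : 0 < r₁ * r₂ * r₃ := by positivity
  have h1 : 0 < -1 - r₁ * r₂ * r₃ + (r₁ * r₂ + r₁ * r₃ + r₂ * r₃ + 2) - (r₁ + r₂ + r₃) := by
    have := mul_pos (mul_pos (sub_pos.2 b₁) (sub_pos.2 b₂)) (sub_pos.2 b₃)
    linarith
  have hQ := intermediate_value_Ioo (zero_le_one' ℝ) (f := fun t : ℝ => -t ^ 3 -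
    r₁ * r₂ * r₃ * t ^ 2 + (r₁ * r₂ + r₁ * r₃ + r₂ * r₃ + 2) * t - (r₁ + r₂ + r₃))
    (by fun_prop)
  obtain ⟨x, hx, hx0⟩ := hQ (show (0 : ℝ) ∈ Set.Ioo _ _ from
    ⟨by norm_num; linarith, by norm_num; linarith⟩)
  refine ⟨x, hx, hx0, ?_, fun y hy hy0 => zero_unique_of_pos_at_one hp.le hx hy hx0 hy0 h1⟩
  have hd : HasDerivAt (fun t : ℝ => -t ^ 3 - r₁ * r₂ * r₃ * t ^ 2 +
      (r₁ * r₂ + r₁ * r₃ + r₂ * r₃ + 2) * t - (r₁ + r₂ + r₃))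
      (-(3 * x ^ 2) - r₁ * r₂ * r₃ * (2 * x) + (r₁ * r₂ + r₁ * r₃ + r₂ * r₃ + 2)) x := by
    have h := ((((hasDerivAt_pow 3 x).fun_neg.fun_sub
      ((hasDerivAt_pow 2 x).const_mul (r₁ * r₂ * r₃))).fun_add
      ((hasDerivAt_id' x).const_mul (r₁ * r₂ + r₁ * r₃ + r₂ * r₃ + 2))).sub_const (r₁ + r₂ + r₃))
    refine h.congr_deriv ?_
    norm_num
  rw [hd.deriv]
  have hs := chord_slope_pos_of_zero hx.2 hx0 h1
  have hpx : 0 ≤ r₁ * r₂ * r₃ * (1 - x) := mul_nonneg hp.le (by linarith [hx.2])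
  refine ne_of_gt ?_
  nlinarith [hx.1, hx.2]
end

section
/- Define E(r₁,r₂,r₃) = −27(r₂ + r₃)(1 + r₂r₃)² + 27r₁(−1 + r₂³r₃ − 2r₃² + r₂r₃(−6 + r₃²) + r₂²(−2 + r₃²)) + r₁³(27r₂r₃ − 27r₃² + r₂³r₃³ + 9r₂²(−3 + 2r₃²)) + 9r₁²(3r₂(−2 + r₃²) − 3r₃(2 + r₃²) + r₂³(−3 + 2r₃²) + r₂²r₃(3 + 2r₃²)). Then E(r₁,r₂,r₃) < 0 for all (r₁,r₂,r₃) ∈ (0,1)³. -/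
/-- The polynomial factor `E(r₁,r₂,r₃)` of the iterated discriminant is negative on the
open unit cube `(0,1)³`. -/
theorem E_neg_on_unit_cube (r₁ r₂ r₃ : ℝ)
    (h₁ : r₁ ∈ Set.Ioo (0:ℝ) 1) (h₂ : r₂ ∈ Set.Ioo (0:ℝ) 1) (h₃ : r₃ ∈ Set.Ioo (0:ℝ) 1) :
    -27 * (r₂ + r₃) * (1 + r₂ * r₃) ^ 2 +
      27 * r₁ * (-1 + r₂ ^ 3 * r₃ - 2 * r₃ ^ 2 + r₂ * r₃ * (-6 + r₃ ^ 2) +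
        r₂ ^ 2 * (-2 + r₃ ^ 2)) +
      r₁ ^ 3 * (27 * r₂ * r₃ - 27 * r₃ ^ 2 + r₂ ^ 3 * r₃ ^ 3 +
        9 * r₂ ^ 2 * (-3 + 2 * r₃ ^ 2)) +
      9 * r₁ ^ 2 * (3 * r₂ * (-2 + r₃ ^ 2) - 3 * r₃ * (2 + r₃ ^ 2) +
        r₂ ^ 3 * (-3 + 2 * r₃ ^ 2) + r₂ ^ 2 * r₃ * (3 + 2 * r₃ ^ 2)) < 0 := by
  obtain ⟨ha, ha'⟩ := h₁
  obtain ⟨hb, hb'⟩ := h₂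
  obtain ⟨hc, hc'⟩ := h₃
  have hbc : r₂ * r₃ < 1 := mul_lt_one_of_nonneg_of_lt_one_left hb.le hb' hc'.le
  have hbc0 : 0 < r₂ * r₃ := mul_pos hb hc
  obtain ⟨q, hq⟩ : ∃ q, q = r₁ * (r₂ * r₃) := ⟨_, rfl⟩
  obtain ⟨s, hs⟩ : ∃ s, s = r₁ + r₂ + r₃ := ⟨_, rfl⟩
  obtain ⟨p, hp⟩ : ∃ p, p = r₁ * r₂ + r₁ * r₃ + r₂ * r₃ := ⟨_, rfl⟩
  have hq0 : 0 < q := hq ▸ mul_pos ha hbc0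
  have hqa : q < r₁ := hq ▸ mul_lt_of_lt_one_right ha hbc
  have hs0 : 0 < s := by linarith
  have hp0 : 0 < p := by rw [hp]; positivity
  have hpqs : 3 * q * s ≤ p ^ 2 := by
    rw [hp, hq, hs]
    nlinarith [sq_nonneg (r₁ * r₂ - r₁ * r₃), sq_nonneg (r₁ * r₂ - r₂ * r₃),
      sq_nonneg (r₁ * r₃ - r₂ * r₃)]
  have hq2 : q ^ 2 < 1 := pow_lt_one₀ hq0.le (hqa.trans ha') two_ne_zero
  have hq3 : q ^ 3 < q ^ 2 * s := by
    rw [pow_succ]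
    exact mul_lt_mul_of_pos_left (by linarith) (pow_pos hq0 2)
  have hneg : s * (-27 * (1 + p) ^ 2 + 81 * q * s + 19 * q ^ 2) < 0 :=
    mul_neg_of_pos_of_neg hs0 (by linarith)
  calc
    _ = -27 * s * (1 + p) ^ 2 + 81 * q * s ^ 2 + 18 * q ^ 2 * s + q ^ 3 := by
      rw [hp, hq, hs]
      ring
    _ < s * (-27 * (1 + p) ^ 2 + 81 * q * s + 19 * q ^ 2) := by linarith
    _ < 0 := hneg
end

section
/- Let a, b, c be real numbers, not all zero, and consider the real polynomials p(x) = a + b·x + c·x² and q(x) = c + b·x + a·x². Then the number of zeros of p in the open interval (0,1), counted with multiplicity, plus the number of zeros of q in (0,1), counted with multiplicity, is at most 2. -/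
open Polynomial

theorem natDegree_const_add_linear_add_sq_le (a b c : ℝ) :
    (C a + C b * X + C c * X ^ 2).natDegree ≤ 2 := by
  compute_degree

theorem numZerosIn01_le_two (a b c : ℝ) : numZerosIn01 (C a + C b * X + C c * X ^ 2) ≤ 2 :=
  (Multiset.card_le_card (Multiset.filter_le _ _)).trans
    ((card_roots' _).trans (natDegree_const_add_linear_add_sq_le a b c))

open scoped Classical in
/-- A polynomial `a + bx + cx²` with two zeros in `(0,1)` splits with both roots there. -/
theorem exists_factorization_of_two_le_numZerosIn01 {a b c : ℝ}
    (h : 2 ≤ numZerosIn01 (C a + C b * X + C c * X ^ 2)) :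
    c ≠ 0 ∧ ∃ u ∈ Set.Ioo (0 : ℝ) 1, ∃ v ∈ Set.Ioo (0 : ℝ) 1,
      b = -c * (u + v) ∧ a = c * u * v := by
  have hcard : 2 ≤ (C a + C b * X + C c * X ^ 2).roots.card :=
    h.trans (Multiset.card_le_card (Multiset.filter_le _ _))
  have hc : c ≠ 0 := by
    rintro rfl
    have hdeg : (C a + C b * X + C 0 * X ^ 2).natDegree ≤ 1 := by
      rw [C_0, zero_mul, add_zero]
      compute_degree
    have := card_roots' (C a + C b * X + C 0 * X ^ 2)
    omega
  have hfilter : (C a + C b * X + C c * X ^ 2).roots.filter (fun x => x ∈ Set.Ioo (0 : ℝ) 1) =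
      (C a + C b * X + C c * X ^ 2).roots := by
    refine Multiset.eq_of_le_of_card_le (Multiset.filter_le _ _) ?_
    refine ((card_roots' _).trans (natDegree_const_add_linear_add_sq_le a b c)).trans ?_
    exact h
  obtain ⟨u, v, huv⟩ := Multiset.card_eq_two.mp
    (le_antisymm ((card_roots' _).trans (natDegree_const_add_linear_add_sq_le a b c)) hcard)
  have hmem := Multiset.filter_eq_self.mp hfilter
  rw [huv] at hmem
  refine ⟨hc, u, hmem u (by simp), v, hmem v (by simp), ?_⟩
  rw [show C a + C b * X + C c * X ^ 2 = C c * X ^ 2 + C b * X + C a by ring] at huv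
  exact (roots_quadratic_eq_pair_iff_of_ne_zero hc).mp huv

/-- If `a + bx + cx²` has two zeros in `(0,1)`, then `c + bx + ax²` has none. -/
theorem numZerosIn01_reciprocal_eq_zero {a b c : ℝ}
    (h : 2 ≤ numZerosIn01 (C a + C b * X + C c * X ^ 2)) :
    numZerosIn01 (C c + C b * X + C a * X ^ 2) = 0 := by
  obtain ⟨hc, u, ⟨hu0, hu1⟩, v, ⟨hv0, hv1⟩, rfl, rfl⟩ :=
    exists_factorization_of_two_le_numZerosIn01 h
  rw [numZerosIn01, Multiset.card_eq_zero, Multiset.filter_eq_nil]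
  rintro y hy ⟨hy0, hy1⟩
  have hroot := isRoot_of_mem_roots hy
  simp only [IsRoot, eval_add, eval_mul, eval_C, eval_X, eval_pow] at hroot
  have huy : 0 < 1 - u * y := by nlinarith
  have hvy : 0 < 1 - v * y := by nlinarith
  refine mul_ne_zero hc (mul_pos huy hvy).ne' ?_
  linear_combination hroot

/-- For `a, b, c` not all zero, the reciprocal polynomials `p(x) = a + bx + cx²` and
`q(x) = c + bx + ax²` have at most 2 zeros in `(0,1)` in total, counted with
multiplicity. -/
theorem zeros_holomorphic_m12 (a b c : ℝ) (hne : ¬ (a = 0 ∧ b = 0 ∧ c = 0)) :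
    numZerosIn01 (C a + C b * X + C c * X ^ 2) +
      numZerosIn01 (C c + C b * X + C a * X ^ 2) ≤ 2 := by
  have hp := numZerosIn01_le_two a b c
  have hq := numZerosIn01_le_two c b a
  by_cases h₁ : 2 ≤ numZerosIn01 (C a + C b * X + C c * X ^ 2)
  · rw [numZerosIn01_reciprocal_eq_zero h₁]
    exact hp
  by_cases h₂ : 2 ≤ numZerosIn01 (C c + C b * X + C a * X ^ 2)
  · rw [numZerosIn01_reciprocal_eq_zero h₂, zero_add]
    exact hq
  omega
end
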